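/- Let n′ be a nonzero linear form on V. (i) For every n′-oriented map α, the triple (O_F, e^{n′}, e^α) is a composition algebra having exactly one point P ∈ F with future →P = F \ {P}, and (O_F, e^{n′}, −e^α) is a composition algebra having exactly one point P ∈ F with past ←P = F \ {P}. (ii) Conversely, if (O_F, e^{n′}, ε) is a composition algebra having exactly one point P ∈ F with →P = F \ {P} (resp. exactly one point P with ←P = F \ {P}), then there exists a unique n′-oriented map α with ε = e^α (resp. ε = −e^α). -/

import Mathlib

open Finset

/-- The ambient `𝔽₂`-vector space (the Fano cube); the Fano plane `F` is its set of
nonzero vectors. -/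
abbrev V : Type := Fin 3 → ZMod 2

/-- A multiplication factor: a sign `ε P Q ∈ {−1,1}` for each ordered pair `(P,Q)` of
distinct points of the Fano plane with `ε Q P = −ε P Q`, normalised to `0` outside its
domain of definition. -/
def IsMulFactor (ε : V → V → ℤ) : Prop :=
  (∀ P Q : V, P ≠ 0 → Q ≠ 0 → P ≠ Q → (ε P Q = 1 ∨ ε P Q = -1) ∧ ε Q P = -ε P Q) ∧
  (∀ P Q : V, P = 0 ∨ Q = 0 ∨ P = Q → ε P Q = 0)

/-- A norm on the Fano plane: a map to `{−1,1}` multiplicative on pairs of distinct points. -/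
def IsNorm (N : V → ℤ) : Prop :=
  (∀ P : V, P ≠ 0 → N P = 1 ∨ N P = -1) ∧
  (∀ P Q : V, P ≠ 0 → Q ≠ 0 → P ≠ Q → N (P + Q) = N P * N Q)

/-- A line of the Fano plane: a 3-element set `{P,Q,R}` of nonzero vectors with `P+Q+R=0`. -/
def IsLine (L : Set V) : Prop :=
  ∃ P Q R : V, P ≠ 0 ∧ Q ≠ 0 ∧ R ≠ 0 ∧ P ≠ Q ∧ P ≠ R ∧ Q ≠ R ∧
    P + Q + R = 0 ∧ L = {P, Q, R}

/-- A triangle: a 3-element subset of the Fano plane which is not a line. -/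
def IsTriangle (T : Set V) : Prop :=
  ∃ P Q R : V, P ≠ 0 ∧ Q ≠ 0 ∧ R ≠ 0 ∧ P ≠ Q ∧ P ≠ R ∧ Q ≠ R ∧
    P + Q + R ≠ 0 ∧ T = {P, Q, R}

/-- A quadrilateral: a 4-element subset of the Fano plane containing no line. -/
def IsQuad (S : Set V) : Prop :=
  (∃ P Q R T : V, P ≠ 0 ∧ Q ≠ 0 ∧ R ≠ 0 ∧ T ≠ 0 ∧
    P ≠ Q ∧ P ≠ R ∧ P ≠ T ∧ Q ≠ R ∧ Q ≠ T ∧ R ≠ T ∧ S = {P, Q, R, T}) ∧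
  (∀ L : Set V, IsLine L → ¬ L ⊆ S)

/-- The future of a point `P`: the points `Q` of the Fano plane with `ε P Q = 1`. -/
def Future (ε : V → V → ℤ) (P : V) : Set V := {Q : V | Q ≠ 0 ∧ Q ≠ P ∧ ε P Q = 1}

/-- The past of a point `P`: the points `Q` of the Fano plane with `ε P Q = −1`. -/
def Past (ε : V → V → ℤ) (P : V) : Set V := {Q : V | Q ≠ 0 ∧ Q ≠ P ∧ ε P Q = -1}

/-- The composition conditions (C1) and (C2) on a multiplication factor. -/
def CompCond (ε : V → V → ℤ) : Prop :=
  (∀ P Q R : V, P ≠ 0 → Q ≠ 0 → R ≠ 0 → P ≠ Q → P ≠ R → Q ≠ R → P + Q + R = 0 →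
    ε P Q * ε Q R = 1) ∧
  (∀ P Q R S : V, P ≠ 0 → Q ≠ 0 → R ≠ 0 → S ≠ 0 →
    P ≠ Q → P ≠ R → P ≠ S → Q ≠ R → Q ≠ S → R ≠ S → IsQuad {P, Q, R, S} →
    ε P Q * ε Q R * ε R S * ε S P = -1)

/-- An oriented triangle `{P,Q,R}`: one with `ε P Q = ε Q R = ε R P`. -/
def OrientedTri (ε : V → V → ℤ) (T : Set V) : Prop :=
  ∃ P Q R : V, T = {P, Q, R} ∧ P ≠ Q ∧ P ≠ R ∧ Q ≠ R ∧
    ε P Q = ε Q R ∧ ε Q R = ε R P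

/-- `P` is the distinguished point of the quadrilateral `S`: the point of `S` whose
complement in `S` is the oriented triangle of `S`. -/
def IsDistPt (ε : V → V → ℤ) (S : Set V) (P : V) : Prop :=
  P ∈ S ∧ IsTriangle (S \ {P}) ∧ OrientedTri ε (S \ {P})

/-- A family of subsets of the Fano plane satisfies the Fano axioms if two distinct points
lie in exactly one member and two distinct members meet in exactly one point. -/
def FanoFamily (Δ : Set (Set V)) : Prop :=
  (∀ P Q : V, P ≠ 0 → Q ≠ 0 → P ≠ Q → ∃! T, T ∈ Δ ∧ P ∈ T ∧ Q ∈ T) ∧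
  (∀ T₁ T₂ : Set V, T₁ ∈ Δ → T₂ ∈ Δ → T₁ ≠ T₂ → ∃! X : V, X ∈ T₁ ∩ T₂)

/-- An `n`-oriented map: `α_P(P) + n(P) = 1` on the Fano plane and
`α_P(Q) + α_Q(P) = 1` for distinct points; normalised by `α 0 = 0`. -/
def IsNOrientedMap (n : V →ₗ[ZMod 2] ZMod 2) (α : V → V →ₗ[ZMod 2] ZMod 2) : Prop :=
  (∀ P : V, P ≠ 0 → α P P + n P = 1) ∧
  (∀ P Q : V, P ≠ 0 → Q ≠ 0 → P ≠ Q → α P Q + α Q P = 1) ∧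
  α 0 = 0

/-- An oriented map is a `0`-oriented map. -/
def IsOrientedMap (α : V → V →ₗ[ZMod 2] ZMod 2) : Prop := IsNOrientedMap 0 α

/-- The exponential `e : ZMod 2 → {−1,1}`, `e^0 = 1`, `e^1 = −1`. -/
def eSign (x : ZMod 2) : ℤ := if x = 0 then 1 else -1

/-- The multiplication factor `e^α` associated to an (`n`-)oriented map `α`. -/
def expMap (α : V → V →ₗ[ZMod 2] ZMod 2) : V → V → ℤ :=
  fun P Q => if P ≠ 0 ∧ Q ≠ 0 ∧ P ≠ Q then eSign (α P Q) else 0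

/-- The set `Δ_P = {Q ∈ F : Q ≠ P, α_P(Q) = 1}` associated to an oriented map. -/
def DeltaSet (α : V → V →ₗ[ZMod 2] ZMod 2) (P : V) : Set V :=
  {Q : V | Q ≠ 0 ∧ Q ≠ P ∧ α P Q = 1}

/-- The map `α ↦ α′`, `α′_P = α_P + n(P)·n`. -/
def nTransform (n : V →ₗ[ZMod 2] ZMod 2) (α : V → V →ₗ[ZMod 2] ZMod 2) :
    V → V →ₗ[ZMod 2] ZMod 2 :=
  fun P => α P + n P • n

/-- The norm `e^{n}` on the Fano plane associated to a linear form `n`. -/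
def NormOf (n : V →ₗ[ZMod 2] ZMod 2) : V → ℤ := fun P => eSign (n P)

/-- Structure constants of the octonion-type multiplication on `O_F` determined by a norm `N`
and a multiplication factor `ε`: `e_0` is a two-sided unit, `e_P ⬝ e_P = −N(P) e_0` and
`e_P ⬝ e_Q = ε_{PQ} e_{P+Q}` for distinct points `P`, `Q` of the Fano plane. -/
def structC (𝔽 : Type*) [Field 𝔽] (N : V → ℤ) (ε : V → V → ℤ) (P Q : V) : 𝔽 :=
  if P = 0 ∨ Q = 0 then 1
  else if P = Q then -(N P : 𝔽)
  else (ε P Q : 𝔽)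

/-- The bilinear multiplication on `O_F = (V → 𝔽)` with the above structure constants
(in `V` we have `X = Y + Z ↔ Z = X + Y`). -/
def octMul (𝔽 : Type*) [Field 𝔽] (N : V → ℤ) (ε : V → V → ℤ) (Z W : V → 𝔽) : V → 𝔽 :=
  fun X => ∑ Y : V, structC 𝔽 N ε Y (X + Y) * Z Y * W (X + Y)

/-- The quadratic form `N_O` on `O_F`. -/
def octNorm (𝔽 : Type*) [Field 𝔽] (N : V → ℤ) (Z : V → 𝔽) : 𝔽 :=
  ∑ X : V, (if X = 0 then 1 else (N X : 𝔽)) * Z X ^ 2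

/-- `(O_F, N, ε)` is a composition algebra: `N_O(Z ⬝ W) = N_O(Z) N_O(W)`. -/
def IsCompAlg (𝔽 : Type*) [Field 𝔽] (N : V → ℤ) (ε : V → V → ℤ) : Prop :=
  ∀ Z W : V → 𝔽, octNorm 𝔽 N (octMul 𝔽 N ε Z W) = octNorm 𝔽 N Z * octNorm 𝔽 N W

theorem eSign_add (x y : ZMod 2) : eSign (x + y) = eSign x * eSign y := by
  revert x y; decide

theorem eSign_mul_self (x : ZMod 2) : eSign x * eSign x = 1 := by
  revert x; decide

theorem eSign_add_one (x : ZMod 2) : eSign (x + 1) = -eSign x := by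
  revert x; decide

theorem eSign_injective : Function.Injective eSign := by
  intro x y; revert x y; decide

theorem eq_one_or_neg_one_iff_exists_eSign {z : ℤ} : (z = 1 ∨ z = -1) ↔ ∃ x, eSign x = z := by
  constructor
  · rintro (rfl | rfl)
    · exact ⟨0, rfl⟩
    · exact ⟨1, rfl⟩
  · rintro ⟨x, rfl⟩
    revert x; decide

theorem add_eq_one_of_eSign_add_eSign {𝔽 : Type*} [Field 𝔽] (hchar : (2 : 𝔽) ≠ 0) {x y : ZMod 2}
    (h : (eSign x : 𝔽) + eSign y = 0) : x + y = 1 := by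
  have key : ∀ x y : ZMod 2, x + y = 1 ∨ (eSign x + eSign y = 2 ∨ eSign x + eSign y = -2) := by
    decide
  rcases key x y with h1 | h1 | h1
  · exact h1
  all_goals
    have h2 := congrArg (Int.cast : ℤ → 𝔽) h1
    push_cast at h2
    rw [h] at h2
    grind

namespace V

theorem add_self (x : V) : x + x = 0 := CharTwo.add_self_eq_zero x

theorem add_cancel (x y : V) : x + (x + y) = y := by rw [← add_assoc, add_self, zero_add]

theorem add_eq_zero_iff {x y : V} : x + y = 0 ↔ x = y :=
  ⟨fun h => by rw [← add_cancel x y, h, add_zero], fun h => h ▸ add_self x⟩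

theorem exists_ne_zero_and_ne : ∀ P : V, ∃ Q, Q ≠ 0 ∧ Q ≠ P := by decide

end V

section Composition

variable {𝔽 : Type*} [Field 𝔽] {n : V →ₗ[ZMod 2] ZMod 2} {ε : V → V → ℤ} {b : V → V → ZMod 2}

theorem octNorm_normOf (Z : V → 𝔽) :
    octNorm 𝔽 (NormOf n) Z = ∑ X, (eSign (n X) : 𝔽) * Z X ^ 2 := by
  refine Finset.sum_congr rfl fun X _ => ?_
  by_cases h : X = 0
  · simp [h, eSign]
  · simp [h, NormOf]

theorem octNorm_single_add_single {E G : V} (hEG : E ≠ G) (u v : 𝔽) :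
    octNorm 𝔽 (NormOf n) (Pi.single E u + Pi.single G v) =
      eSign (n E) * u ^ 2 + eSign (n G) * v ^ 2 := by
  rw [octNorm_normOf, ← Finset.sum_subset (Finset.subset_univ {E, G})]
  · rw [Finset.sum_pair hEG]
    simp [hEG, hEG.symm]
  · intro X _ hX
    simp only [Finset.mem_insert, Finset.mem_singleton, not_or] at hX
    simp [hX.1, hX.2]

theorem octMul_single_add_single (N : V → ℤ) (A B C D : V) :
    octMul 𝔽 N ε (Pi.single A 1 + Pi.single B 1) (Pi.single C 1 + Pi.single D 1) =
      Pi.single (A + C) (structC 𝔽 N ε A C) + Pi.single (A + D) (structC 𝔽 N ε A D) +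
      (Pi.single (B + C) (structC 𝔽 N ε B C) + Pi.single (B + D) (structC 𝔽 N ε B D)) := by
  have key : ∀ X A C : V, ∑ Y, structC 𝔽 N ε Y (X + Y) * (Pi.single A 1 : V → 𝔽) Y *
      (Pi.single C 1 : V → 𝔽) (X + Y) = (Pi.single (A + C) (structC 𝔽 N ε A C) : V → 𝔽) X := by
    intro X A C
    rw [Finset.sum_eq_single A (fun Y _ hY => by simp [hY]) (by simp)]
    by_cases h : X = A + C
    · subst h
      rw [add_comm (A + C) A, V.add_cancel]; simp
    · have h' : X + A ≠ C := fun e => h (by rw [← e, add_comm X A, V.add_cancel])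
      simp [h, h']
  funext X
  simp only [octMul, Pi.add_apply, mul_add, add_mul, Finset.sum_add_distrib, key]
  ring

theorem IsCompAlg.add_eq (hchar : (2 : 𝔽) ≠ 0)
    (hb : ∀ P Q, structC 𝔽 (NormOf n) ε P Q = eSign (b P Q))
    (h : IsCompAlg 𝔽 (NormOf n) ε) (A C : V) {T : V} (hT : T ≠ 0) :
    b A C + b (A + T) (C + T) + (b A (C + T) + b (A + T) C) = 1 + n T := by
  have h1 := h (Pi.single A 1 + Pi.single (A + T) 1) (Pi.single C 1 + Pi.single (C + T) 1)
  have hs : ∀ X : V, X ≠ X + T := fun X => by simpa using hT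
  have e1 : A + T + C = A + C + T := by abel
  have e2 : A + (C + T) = A + C + T := by abel
  have e3 : A + T + (C + T) = A + C := by
    rw [add_add_add_comm, V.add_self, add_zero]
  have e4 : ∀ u v w x : V → 𝔽, u + v + (w + x) = u + x + (v + w) := fun _ _ _ _ => by abel
  rw [octMul_single_add_single, e1, e2, e3, e4, ← Pi.single_add, ← Pi.single_add,
    octNorm_single_add_single (hs _), octNorm_single_add_single (hs _),
    octNorm_single_add_single (hs _)] at h1
  simp only [hb, map_add, eSign_add, Int.cast_mul] at h1
  have sq : ∀ x, (eSign x : 𝔽) * eSign x = 1 := fun x => by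
    rw [← Int.cast_mul, eSign_mul_self, Int.cast_one]
  have h2 : (eSign (b A C + b (A + T) (C + T)) : 𝔽) +
      eSign (n T + (b A (C + T) + b (A + T) C)) = 0 := by
    simp only [eSign_add, Int.cast_mul]
    grind
  have h3 := add_eq_one_of_eSign_add_eSign hchar h2
  clear h1 h2
  generalize b A C + b (A + T) (C + T) = p at *
  generalize b A (C + T) + b (A + T) C = q at *
  generalize n T = r at *
  revert p q r
  decide

theorem isCompAlg_of_add_eq (hchar : (2 : 𝔽) ≠ 0)
    (hb : ∀ P Q, structC 𝔽 (NormOf n) ε P Q = eSign (b P Q))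
    (h : ∀ A C T, T ≠ 0 → b A C + b (A + T) (C + T) + (b A (C + T) + b (A + T) C) = 1 + n T) :
    IsCompAlg 𝔽 (NormOf n) ε := by
  intro Z W
  set G : V → V → V → 𝔽 := fun T Y U =>
    eSign (n (Y + U) + (b Y U + b (Y + T) (U + T))) * (Z Y * Z (Y + T) * (W U * W (U + T))) with hG
  have expand : octNorm 𝔽 (NormOf n) (octMul 𝔽 (NormOf n) ε Z W) = ∑ T, ∑ Y, ∑ U, G T Y U := by
    have : ∀ X, (eSign (n X) : 𝔽) * octMul 𝔽 (NormOf n) ε Z W X ^ 2 =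
        ∑ Y, ∑ T, G T Y (Y + X) := by
      intro X
      rw [pow_two, octMul, Finset.sum_mul_sum, Finset.mul_sum]
      refine Finset.sum_congr rfl fun Y _ => ?_
      rw [Finset.mul_sum, ← Equiv.sum_comp (Equiv.addLeft Y)]
      refine Finset.sum_congr rfl fun T _ => ?_
      have e : X + (Y + T) = Y + X + T := by abel
      simp only [hG, hb, Equiv.coe_addLeft, V.add_cancel, eSign_add, Int.cast_mul, e, add_comm X Y]
      ring
    rw [octNorm_normOf]
    simp only [this]
    rw [Finset.sum_comm]
    have : ∀ Y, ∑ X, ∑ T, G T Y (Y + X) = ∑ T, ∑ U, G T Y U := by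
      intro Y
      rw [Finset.sum_comm]
      exact Finset.sum_congr rfl fun T _ => Equiv.sum_comp (Equiv.addLeft Y) (G T Y)
    simp only [this]
    exact Finset.sum_comm
  have vanish : ∀ T, T ≠ 0 → ∑ Y, ∑ U, G T Y U = 0 := by
    intro T hT
    refine Finset.sum_eq_zero fun Y _ => ?_
    have anti : ∀ U, G T Y (U + T) = -G T Y U := by
      intro U
      have e : U + T + T = U := by rw [add_assoc, V.add_self, add_zero]
      have e2 : n (Y + (U + T)) + (b Y (U + T) + b (Y + T) U) =
          n (Y + U) + (b Y U + b (Y + T) (U + T)) + 1 := by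
        have h1 := h Y U T hT
        simp only [map_add]
        generalize b Y U + b (Y + T) (U + T) = p at *
        generalize b Y (U + T) + b (Y + T) U = q at *
        generalize n T = r at *
        generalize n Y = s at *
        generalize n U = t at *
        revert p q r s t
        decide
      simp only [hG, e, e2, eSign_add_one]
      push_cast
      ring
    have hS := Equiv.sum_comp (Equiv.addRight T) (G T Y)
    simp only [Equiv.coe_addRight, anti, Finset.sum_neg_distrib] at hS
    have : (2 : 𝔽) * ∑ U, G T Y U = 0 := by linear_combination -hS
    exact (mul_eq_zero.mp this).resolve_left hchar
  rw [expand, Finset.sum_eq_single 0 (fun T _ hT => vanish T hT) (by simp), octNorm_normOf,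
    octNorm_normOf, Finset.sum_mul_sum]
  refine Finset.sum_congr rfl fun Y _ => Finset.sum_congr rfl fun U _ => ?_
  have hsq : (eSign (b Y U) : 𝔽) * eSign (b Y U) = 1 := by
    rw [← Int.cast_mul, eSign_mul_self, Int.cast_one]
  simp only [hG, add_zero, map_add, eSign_add, Int.cast_mul, hsq]
  ring

theorem octMul_flip (N : V → ℤ) (Z W : V → 𝔽) :
    octMul 𝔽 N (fun P Q => ε Q P) Z W = octMul 𝔽 N ε W Z := by
  funext X
  rw [octMul, octMul, ← Equiv.sum_comp (Equiv.addLeft X)]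
  refine Finset.sum_congr rfl fun Y _ => ?_
  have : structC 𝔽 N (fun P Q => ε Q P) (X + Y) Y = structC 𝔽 N ε Y (X + Y) := by
    grind [structC]
  simp only [Equiv.coe_addLeft, V.add_cancel, this]
  ring

theorem IsCompAlg.flip {N : V → ℤ} (h : IsCompAlg 𝔽 N ε) :
    IsCompAlg 𝔽 N (fun P Q => ε Q P) := fun Z W => by
  rw [octMul_flip, h W Z, mul_comm]

end Composition

namespace IsNOrientedMap

variable {n : V →ₗ[ZMod 2] ZMod 2} {α β : V → V →ₗ[ZMod 2] ZMod 2}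

theorem structC_expMap {𝔽 : Type*} [Field 𝔽] (hα : IsNOrientedMap n α) (P Q : V) :
    structC 𝔽 (NormOf n) (expMap α) P Q = eSign (α P Q) := by
  obtain ⟨h1, -, h0⟩ := hα
  by_cases hP : P = 0
  · simp [structC, hP, h0, eSign]
  by_cases hQ : Q = 0
  · simp [structC, hQ, eSign]
  by_cases hPQ : P = Q
  · subst hPQ
    have : α P P = n P + 1 := by rw [← h1 P hP, add_left_comm, CharTwo.add_self_eq_zero, add_zero]
    simp [structC, hP, NormOf, this, eSign_add_one]
  · simp [structC, hP, hQ, hPQ, expMap]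

theorem apply_add (hα : IsNOrientedMap n α) {A B : V} (hAB : A ≠ B) :
    α A (A + B) + α B (A + B) = 1 + n (A + B) := by
  obtain ⟨h1, h2, h0⟩ := hα
  by_cases hA : A = 0
  · subst hA
    have := h1 B hAB.symm
    simp only [h0, zero_add, LinearMap.zero_apply]
    grind
  by_cases hB : B = 0
  · subst hB
    have := h1 A hAB
    simp only [h0, add_zero, LinearMap.zero_apply]
    grind
  have := h1 A hA
  have := h1 B hB
  have := h2 A B hA hB hAB
  simp only [map_add]
  grind

theorem isCompAlg {𝔽 : Type*} [Field 𝔽] (hchar : (2 : 𝔽) ≠ 0) (hα : IsNOrientedMap n α) :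
    IsCompAlg 𝔽 (NormOf n) (expMap α) := by
  refine isCompAlg_of_add_eq hchar hα.structC_expMap fun A C T hT => ?_
  have h := hα.apply_add (A := A) (B := A + T) (by simpa using hT)
  rw [V.add_cancel] at h
  simp only [map_add] at h ⊢
  grind

theorem neg_expMap (hα : IsNOrientedMap n α) :
    (fun P Q => -expMap α P Q) = fun P Q => expMap α Q P := by
  funext P Q
  by_cases h : P ≠ 0 ∧ Q ≠ 0 ∧ P ≠ Q
  · have h2 := hα.2.1 P Q h.1 h.2.1 h.2.2
    have : α Q P = α P Q + 1 := by rw [← h2, ← add_assoc, CharTwo.add_self_eq_zero, zero_add]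
    simp [expMap, h, h.2.2.symm, this, eSign_add_one]
  · have h' : ¬(Q ≠ 0 ∧ P ≠ 0 ∧ Q ≠ P) := fun k => h ⟨k.2.1, k.1, k.2.2.symm⟩
    simp [expMap, h, h']

theorem expMap_injective (hα : IsNOrientedMap n α) (hβ : IsNOrientedMap n β)
    (h : expMap α = expMap β) : α = β := by
  funext P
  by_cases hP : P = 0
  · rw [hP, hα.2.2, hβ.2.2]
  refine LinearMap.ext fun Q => ?_
  by_cases hQ : Q = 0
  · simp [hQ]
  by_cases hPQ : P = Q
  · subst hPQ
    exact add_right_cancel ((hα.1 P hP).trans (hβ.1 P hP).symm)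
  · have := congrFun (congrFun h P) Q
    exact eSign_injective (by simpa [expMap, hP, hQ, hPQ] using this)

/-- The map `α ↦ α′` turns `n`-oriented maps into oriented maps. -/
theorem isOrientedMap_nTransform (hα : IsNOrientedMap n α) :
    IsOrientedMap (nTransform n α) := by
  refine ⟨fun P hP => ?_, fun P Q hP hQ hPQ => ?_, ?_⟩
  · have key : ∀ x y : ZMod 2, x + y = 1 → x + y * y + 0 = 1 := by decide
    simpa [nTransform] using key _ _ (hα.1 P hP)
  · have key : ∀ x y u v : ZMod 2, x + y = 1 → x + u * v + (y + v * u) = 1 := by decide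
    simpa [nTransform] using key _ _ (n P) (n Q) (hα.2.1 P Q hP hQ hPQ)
  · simp [nTransform, hα.2.2]

theorem _root_.IsOrientedMap.bijective (hα : IsOrientedMap α) : Function.Bijective α := by
  have hcard : Nat.card V = Nat.card (V →ₗ[ZMod 2] ZMod 2) :=
    Nat.card_congr (Module.Basis.toDualEquiv (Pi.basisFun (ZMod 2) (Fin 3))).toEquiv
  have : Finite (V →ₗ[ZMod 2] ZMod 2) :=
    Finite.of_equiv V (Module.Basis.toDualEquiv (Pi.basisFun (ZMod 2) (Fin 3))).toEquiv
  refine (Nat.bijective_iff_injective_and_card α).mpr ⟨fun A B h => ?_, hcard⟩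
  by_contra hAB
  have := apply_add hα hAB
  rw [h, CharTwo.add_self_eq_zero] at this
  simp at this

theorem exists_eq_zero (hα : IsNOrientedMap n α) (hn : n ≠ 0) : ∃ P, P ≠ 0 ∧ α P = 0 := by
  have hα' := hα.isOrientedMap_nTransform
  obtain ⟨P, hP⟩ := hα'.bijective.2 n
  have hP0 : P ≠ 0 := fun h => hn (by rw [← hP, h, hα'.2.2])
  have h1 : n P = 1 := by simpa [hP] using hα'.1 P hP0
  exact ⟨P, hP0, by simpa [nTransform, h1] using hP⟩

theorem _root_.future_expMap_eq_iff {P : V} (hP : P ≠ 0) :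
    Future (expMap α) P = {Q : V | Q ≠ 0 ∧ Q ≠ P} ↔ α P = 0 := by
  constructor
  · intro h
    have h0 : ∀ Q, Q ≠ P → α P Q = 0 := by
      intro Q hQP
      by_cases hQ : Q = 0
      · simp [hQ]
      have : Q ∈ Future (expMap α) P := h ▸ ⟨hQ, hQP⟩
      refine @eSign_injective _ 0 ?_
      simpa [expMap, hP, hQ, hQP.symm, eSign] using this.2.2
    refine LinearMap.ext fun Q => ?_
    by_cases hQP : Q = P
    · subst hQP
      obtain ⟨R, hR, hRQ⟩ := V.exists_ne_zero_and_ne Q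
      have : α Q (R + (R + Q)) = 0 := by
        rw [map_add, h0 R hRQ, h0 (R + Q) (by simpa using hR), add_zero]
      rwa [V.add_cancel] at this
    · exact h0 Q hQP
  · intro h
    ext Q
    simp only [Future, expMap, Set.mem_ofPred_eq]
    refine ⟨fun k => ⟨k.1, k.2.1⟩, fun k => ⟨k.1, k.2, ?_⟩⟩
    simp [hP, k.1, k.2.symm, h, eSign]

theorem existsUnique_future_eq (hα : IsNOrientedMap n α) (hn : n ≠ 0) :
    ∃! P : V, P ≠ 0 ∧ Future (expMap α) P = {Q : V | Q ≠ 0 ∧ Q ≠ P} := by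
  obtain ⟨P, hP, h⟩ := hα.exists_eq_zero hn
  refine ⟨P, ⟨hP, (future_expMap_eq_iff hP).mpr h⟩, fun Q ⟨hQ, hQ'⟩ => ?_⟩
  by_contra hPQ
  have := hα.2.1 Q P hQ hP hPQ
  rw [h, (future_expMap_eq_iff hQ).mp hQ'] at this
  simp at this

end IsNOrientedMap

theorem past_neg (ε : V → V → ℤ) (P : V) : Past (fun P Q => -ε P Q) P = Future ε P := by
  simp [Past, Future, neg_inj]

theorem future_neg (ε : V → V → ℤ) (P : V) : Future (fun P Q => -ε P Q) P = Past ε P := by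
  simp [Past, Future, neg_eq_iff_eq_neg]

theorem IsMulFactor.neg_eq_flip {ε : V → V → ℤ} (hε : IsMulFactor ε) :
    (fun P Q => -ε P Q) = fun P Q => ε Q P := by
  funext P Q
  by_cases h : P = 0 ∨ Q = 0 ∨ P = Q
  · rw [hε.2 P Q h, hε.2 Q P (by tauto), neg_zero]
  · push Not at h
    exact (hε.1 P Q h.1 h.2.1 h.2.2).2.symm

theorem IsMulFactor.neg {ε : V → V → ℤ} (hε : IsMulFactor ε) :
    IsMulFactor (fun P Q => -ε P Q) :=
  ⟨fun P Q hP hQ h => ⟨by have := (hε.1 P Q hP hQ h).1; dsimp only; omega,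
    congrArg Neg.neg (hε.1 P Q hP hQ h).2⟩, fun P Q h => neg_eq_zero.mpr (hε.2 P Q h)⟩

/-- A plane of `V` and a nonzero coset of it exhaust `V`, so additivity along a plane implies
additivity. -/
theorem map_add_of_map_add_span {f : V → ZMod 2} {B P : V} (hB : B ≠ 0) (hP : P ≠ 0) (hBP : B ≠ P)
    (h0 : f 0 = 0) (hfB : ∀ C, f (C + B) = f C + f B) (hfP : ∀ C, f (C + P) = f C + f P) (C D : V) :
    f (C + D) = f C + f D := by
  have cover : ∀ B P C D : V, B ≠ 0 → P ≠ 0 → B ≠ P →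
      (C = 0 ∨ C = B ∨ C = P ∨ C = B + P) ∨ (D = 0 ∨ D = B ∨ D = P ∨ D = B + P) ∨
      (D = C ∨ D = C + B ∨ D = C + P ∨ D = C + B + P) := by
    set_option synthInstance.maxSize 1000 in decide +kernel
  have two : ∀ x : ZMod 2, x + x = 0 := CharTwo.add_self_eq_zero
  have e1 : ∀ C, f (C + (B + P)) = f C + f B + f P := fun C => by rw [← add_assoc, hfP, hfB]
  rcases cover B P C D hB hP hBP with (rfl | rfl | rfl | rfl) | (rfl | rfl | rfl | rfl) |
    (rfl | rfl | rfl | rfl)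
  · rw [zero_add, h0, zero_add]
  · rw [add_comm, hfB, add_comm]
  · rw [add_comm, hfP, add_comm]
  · rw [add_comm, e1, hfP]; abel
  · rw [add_zero, h0, add_zero]
  · exact hfB C
  · exact hfP C
  · rw [e1, hfP]; abel
  · rw [V.add_self, h0, two]
  · rw [V.add_cancel, hfB, ← add_assoc, two, zero_add]
  · rw [V.add_cancel, hfP, ← add_assoc, two, zero_add]
  · rw [add_assoc, V.add_cancel, e1, hfP, add_assoc (f C), ← add_assoc (f C), two, zero_add]

section Converse

variable {𝔽 : Type*} [Field 𝔽] {n : V →ₗ[ZMod 2] ZMod 2} {ε : V → V → ℤ}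

theorem IsMulFactor.exists_exponent (hε : IsMulFactor ε) (P Q : V) :
    ∃ x, structC 𝔽 (NormOf n) ε P Q = eSign x ∧ (P = 0 ∨ Q = 0 → x = 0) ∧
      (P ≠ 0 → P = Q → x = 1 + n P) ∧ (P ≠ 0 → Q ≠ 0 → P ≠ Q → eSign x = ε P Q) := by
  by_cases h : P = 0 ∨ Q = 0
  · exact ⟨0, by simp [structC, h, eSign], by tauto, by grind, by tauto⟩
  push Not at h
  by_cases hPQ : P = Q
  · exact ⟨1 + n P, by simp [structC, ← hPQ, h.1, NormOf, add_comm 1 (n P), eSign_add_one], by tauto,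
      fun _ _ => rfl, by tauto⟩
  · obtain ⟨x, hx⟩ := eq_one_or_neg_one_iff_exists_eSign.mp (hε.1 P Q h.1 h.2 hPQ).1
    exact ⟨x, by simp [structC, h.1, h.2, hPQ, hx], by tauto, by tauto, fun _ _ _ => hx⟩

theorem IsCompAlg.exists_eq_expMap (hchar : (2 : 𝔽) ≠ 0) (hε : IsMulFactor ε)
    (h : IsCompAlg 𝔽 (NormOf n) ε) {P : V} (hP : P ≠ 0)
    (hF : Future ε P = {Q : V | Q ≠ 0 ∧ Q ≠ P}) :
    ∃ α : V → V →ₗ[ZMod 2] ZMod 2, IsNOrientedMap n α ∧ ε = expMap α := by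
  choose b hb hb0 hb1 hb2 using hε.exists_exponent (𝔽 := 𝔽) (n := n)
  have rel := fun A C T hT => h.add_eq hchar hb A C (T := T) hT
  have two : ∀ x : ZMod 2, x + x = 0 := CharTwo.add_self_eq_zero
  have anti : ∀ A B, A ≠ 0 → B ≠ 0 → A ≠ B → b A B + b B A = 1 := by
    intro A B hA hB hAB
    have : eSign (b B A) = eSign (b A B + 1) := by
      rw [eSign_add_one, hb2 A B hA hB hAB, hb2 B A hB hA hAB.symm, (hε.1 A B hA hB hAB).2]
    rw [eSign_injective this, ← add_assoc, two, zero_add]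
  have shift_self : ∀ A C, A ≠ 0 → b A (C + A) = b A C + b A A := by
    intro A C hA
    have := rel 0 C A hA
    rw [zero_add, hb0 0 _ (.inl rfl), hb0 0 _ (.inl rfl)] at this
    rw [hb1 A A hA rfl]
    grind
  have future_zero : ∀ Q, Q ≠ P → b P Q = 0 := by
    intro Q hQP
    by_cases hQ : Q = 0
    · exact hb0 P Q (.inr hQ)
    have : Q ∈ Future ε P := hF ▸ ⟨hQ, hQP⟩
    exact eSign_injective ((hb2 P Q hP hQ hQP.symm).trans this.2.2)
  have hPP : b P P = 0 := by
    obtain ⟨R, hR, hRP⟩ := V.exists_ne_zero_and_ne P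
    have := shift_self P R hP
    rw [future_zero R hRP, future_zero (R + P) (by simpa using hR), zero_add] at this
    exact this.symm
  have row_zero : ∀ Q, b P Q = 0 := fun Q => by
    by_cases hQP : Q = P
    · rw [hQP, hPP]
    · exact future_zero Q hQP
  have hnP : n P = 1 := by
    have := hb1 P P hP rfl
    rw [hPP] at this
    grind
  have shift_P : ∀ A C, A ≠ 0 → A ≠ P → b A (C + P) = b A C + b A P := by
    intro A C hA hAP
    have h1 := rel P (C + P) (P + A) (fun e => hAP (V.add_eq_zero_iff.mp e).symm)
    have h2 : C + P + (P + A) = C + A := by rw [add_assoc, V.add_cancel]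
    rw [h2, V.add_cancel, row_zero, row_zero, shift_self A C hA, hb1 A A hA rfl, map_add, hnP] at h1
    have h3 := anti A P hA hP hAP
    rw [row_zero] at h3
    grind
  have additive : ∀ A C D, b A (C + D) = b A C + b A D := by
    intro A C D
    by_cases hA : A = 0
    · simp only [hb0 A _ (.inl hA), add_zero]
    by_cases hAP : A = P
    · simp only [hAP, row_zero, add_zero]
    exact map_add_of_map_add_span hA hP hAP (hb0 A 0 (.inr rfl)) (fun C => shift_self A C hA)
      (fun C => shift_P A C hA hAP) C D
  let α : V → V →ₗ[ZMod 2] ZMod 2 := fun A =>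
    AddMonoidHom.toZModLinearMap 2
      { toFun := b A, map_zero' := hb0 A 0 (.inr rfl), map_add' := additive A }
  have hα : ∀ A C, α A C = b A C := fun _ _ => rfl
  refine ⟨α, ⟨fun A hA => ?_, anti, LinearMap.ext fun C => hb0 0 C (.inl rfl)⟩, ?_⟩
  · rw [hα, hb1 A A hA rfl, add_assoc, two, add_zero]
  · funext A C
    by_cases hAC : A ≠ 0 ∧ C ≠ 0 ∧ A ≠ C
    · rw [expMap, if_pos hAC, hα, hb2 A C hAC.1 hAC.2.1 hAC.2.2]
    · rw [expMap, if_neg hAC, hε.2 A C (by tauto)]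

end Converse

/-- for `n′ ≠ 0`: (i) for every `n′`-oriented map `α`,
`(O_F, e^{n′}, e^α)` is a composition algebra with exactly one point whose future is
`F \ {P}`, and `(O_F, e^{n′}, −e^α)` one with exactly one point whose past is `F \ {P}`;
(ii) conversely every such composition algebra arises from a unique `n′`-oriented map. -/
theorem stmt_19 (𝔽 : Type*) [Field 𝔽] (hchar : (2 : 𝔽) ≠ 0)
    (n' : V →ₗ[ZMod 2] ZMod 2) (hn' : n' ≠ 0) :
    (∀ α : V → V →ₗ[ZMod 2] ZMod 2, IsNOrientedMap n' α →
      (IsCompAlg 𝔽 (NormOf n') (expMap α) ∧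
        ∃! P : V, P ≠ 0 ∧ Future (expMap α) P = {Q : V | Q ≠ 0 ∧ Q ≠ P}) ∧
      (IsCompAlg 𝔽 (NormOf n') (fun P Q => -expMap α P Q) ∧
        ∃! P : V, P ≠ 0 ∧
          Past (fun P Q => -expMap α P Q) P = {Q : V | Q ≠ 0 ∧ Q ≠ P})) ∧
    (∀ ε : V → V → ℤ, IsMulFactor ε → IsCompAlg 𝔽 (NormOf n') ε →
      ((∃! P : V, P ≠ 0 ∧ Future ε P = {Q : V | Q ≠ 0 ∧ Q ≠ P}) →
        ∃! α : V → V →ₗ[ZMod 2] ZMod 2, IsNOrientedMap n' α ∧ ε = expMap α) ∧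
      ((∃! P : V, P ≠ 0 ∧ Past ε P = {Q : V | Q ≠ 0 ∧ Q ≠ P}) →
        ∃! α : V → V →ₗ[ZMod 2] ZMod 2, IsNOrientedMap n' α ∧
          ε = fun P Q => -expMap α P Q)) := by
  refine ⟨fun α hα => ⟨⟨hα.isCompAlg hchar, hα.existsUnique_future_eq hn'⟩, ?_, ?_⟩,
    fun ε hε h => ⟨?_, ?_⟩⟩
  · rw [hα.neg_expMap]
    exact (hα.isCompAlg hchar).flip
  · simpa only [past_neg] using hα.existsUnique_future_eq hn'
  · rintro ⟨P, ⟨hP, hF⟩, -⟩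
    obtain ⟨α, hα, rfl⟩ := h.exists_eq_expMap hchar hε hP hF
    exact ⟨α, ⟨hα, rfl⟩, fun β hβ => hβ.1.expMap_injective hα hβ.2.symm⟩
  · rintro ⟨P, ⟨hP, hF⟩, -⟩
    have h' : IsCompAlg 𝔽 (NormOf n') (fun P Q => -ε P Q) := hε.neg_eq_flip ▸ h.flip
    obtain ⟨α, hα, hεα⟩ := h'.exists_eq_expMap hchar hε.neg hP ((future_neg ε P).trans hF)
    have iff_neg : ∀ β, ε = (fun P Q => -expMap β P Q) ↔ expMap β = fun P Q => -ε P Q := fun β => by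
      simp only [funext_iff, eq_neg_iff_add_eq_zero, add_comm]
    exact ⟨α, ⟨hα, (iff_neg α).mpr hεα.symm⟩, fun β hβ =>
      hβ.1.expMap_injective hα (((iff_neg β).mp hβ.2).trans hεα)⟩
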